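/- Let T > 0 and let (𝓜, u) be a conformal Ricci flow spacetime in the ambient space ℂ × (0,T) which is complete. Then 𝓜 is expanding: for every (z,t) ∈ 𝓜 and every t′ with t ≤ t′ < T, one has (z,t′) ∈ 𝓜. -/

import Mathlib

open Set MeasureTheory Filter Metric

/-- The Euclidean Laplacian of `f : ℂ → ℝ` at `z`, i.e. `∂²f/∂x² + ∂²f/∂y²`. -/
noncomputable def lap (f : ℂ → ℝ) (z : ℂ) : ℝ :=
  iteratedFDeriv ℝ 2 f z ![1, 1] + iteratedFDeriv ℝ 2 f z ![Complex.I, Complex.I]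

/-- The time-timeSlice of a spacetime `M ⊆ ℂ × ℝ` at time `t`. -/
def timeSlice (M : Set (ℂ × ℝ)) (t : ℝ) : Set ℂ := {z | (z, t) ∈ M}

/-- The conformal distance on `Ω` induced by a conformal factor `v`: the infimum of
`v`-lengths of `C¹` paths in `Ω` joining `x` to `y`. -/
noncomputable def confDist (v : ℂ → ℝ) (Ω : Set ℂ) (x y : ℂ) : ℝ :=
  sInf {L : ℝ | ∃ γ : ℝ → ℂ, ContDiffOn ℝ 1 γ (Icc 0 1) ∧
    (∀ s ∈ Icc (0:ℝ) 1, γ s ∈ Ω) ∧ γ 0 = x ∧ γ 1 = y ∧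
    L = ∫ s in (0:ℝ)..1, Real.sqrt (v (γ s)) * ‖derivWithin γ (Icc 0 1) s‖}

/-- The conformal ball of centre `p` and radius `ρ` in `Ω` for the metric `v|dz|²`. -/
def confBall (v : ℂ → ℝ) (Ω : Set ℂ) (p : ℂ) (ρ : ℝ) : Set ℂ :=
  {z ∈ connectedComponentIn Ω p | confDist v Ω p z < ρ}

/-- The conformal metric `v|dz|²` is complete on `Ω`: every connected component of `Ω` is a
complete metric space with respect to the induced distance `confDist v Ω`. -/
def ConfComplete (v : ℂ → ℝ) (Ω : Set ℂ) : Prop :=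
  ∀ x₀ ∈ Ω, ∀ x : ℕ → ℂ, (∀ n, x n ∈ connectedComponentIn Ω x₀) →
    (∀ ε : ℝ, 0 < ε → ∃ N : ℕ, ∀ m ≥ N, ∀ n ≥ N, confDist v Ω (x m) (x n) < ε) →
    ∃ l ∈ connectedComponentIn Ω x₀,
      Tendsto (fun n => confDist v Ω (x n) l) atTop (nhds 0)

/-- A conformal Ricci flow spacetime in the ambient space `ℂ × (0,T)`:
`M` is a connected open subset of `ℂ × (0,T)` with non-empty time-slices, and `u` is a smooth
positive conformal factor on `M` solving the logarithmic fast diffusion equation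
`∂u/∂t = Δ log u`. -/
structure ConfRFS (T : ℝ) (M : Set (ℂ × ℝ)) (u : ℂ → ℝ → ℝ) : Prop where
  sub : M ⊆ {p : ℂ × ℝ | p.2 ∈ Ioo 0 T}
  opn : IsOpen M
  conn : IsConnected M
  nonempty : ∀ t ∈ Ioo (0:ℝ) T, (timeSlice M t).Nonempty
  pos : ∀ p ∈ M, 0 < u p.1 p.2
  smooth : ContDiffOn ℝ (⊤ : ℕ∞) (fun p : ℂ × ℝ => u p.1 p.2) M
  lfde : ∀ p ∈ M, deriv (u p.1) p.2 = lap (fun z => Real.log (u z p.2)) p.1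

/-- A conformal Ricci flow spacetime is complete if the metric `u(·,t)|dz|²` is complete on the
timeSlice `M_t` for every `t ∈ (0,T)`. -/
def ConfRFSComplete (T : ℝ) (M : Set (ℂ × ℝ)) (u : ℂ → ℝ → ℝ) : Prop :=
  ∀ t ∈ Ioo (0:ℝ) T, ConfComplete (fun z => u z t) (timeSlice M t)

/-- There is a time-preserving path in `M` from time `s` to the point `(z,t)`. -/
def TimePreservingFrom (M : Set (ℂ × ℝ)) (s : ℝ) (z : ℂ) (t : ℝ) : Prop :=
  ∃ γ : ℝ → ℂ, ContinuousOn γ (Icc s t) ∧ (∀ r ∈ Icc s t, (γ r, r) ∈ M) ∧ γ t = z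

/-- The hindsight function of a spacetime `M`. -/
noncomputable def hindsight (M : Set (ℂ × ℝ)) (z : ℂ) (t : ℝ) : ℝ :=
  sInf {s : ℝ | 0 < s ∧ s ≤ t ∧ TimePreservingFrom M s z t}

/-- A spacetime is initially determined if its hindsight function vanishes identically. -/
def InitiallyDetermined (M : Set (ℂ × ℝ)) : Prop :=
  ∀ p ∈ M, hindsight M p.1 p.2 = 0

/-- A spacetime in `ℂ × (0,T)` is expanding if worldlines persist until the final time. -/
def Expanding (T : ℝ) (M : Set (ℂ × ℝ)) : Prop :=
  ∀ (z : ℂ) (t t' : ℝ), (z, t) ∈ M → t ≤ t' → t' < T → (z, t') ∈ M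

/-- An expanding spacetime is continuous if each timeSlice is the interior of the intersection of
all later slices. -/
def ContinuousSpacetime (T : ℝ) (M : Set (ℂ × ℝ)) : Prop :=
  ∀ s ∈ Ioo (0:ℝ) T, timeSlice M s = interior (⋂ t ∈ Ioo s T, timeSlice M t)

/-- The vanishing time of the point `(z,t)`: the supremum of the connected component containing
`t` of the set of times at which `z` belongs to the spacetime. -/
noncomputable def vanishTime (M : Set (ℂ × ℝ)) (z : ℂ) (t : ℝ) : ℝ :=
  sSup (connectedComponentIn {r : ℝ | (z, r) ∈ M} t)

/-- A function with a local maximum has nonpositive second derivative there. -/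
lemma IsLocalMax.second_deriv_nonpos {h h' : ℝ → ℝ} {x d : ℝ} (hmax : IsLocalMax h x)
    (hh : ∀ᶠ s in nhds x, HasDerivAt h (h' s) s) (hd : HasDerivAt h' d x) : d ≤ 0 := by
  by_contra! hpos
  have he : deriv h =ᶠ[nhds x] h' := hh.mono fun s hs => hs.deriv
  have hdd : deriv (deriv h) x = d := by rw [he.deriv_eq, hd.deriv]
  have hmin : IsLocalMin h x := isLocalMin_of_deriv_deriv_pos (by rw [hdd]; exact hpos)
    hmax.deriv_eq_zero hh.self_of_nhds.continuousAt
  have hc : h =ᶠ[nhds x] fun _ => h x := by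
    filter_upwards [hmin, hmax] with s h1 h2 using le_antisymm h2 h1
  have : deriv (deriv h) x = 0 := by
    rw [hc.deriv.deriv_eq]; simp
  linarith

/-- The first and second derivatives of a `C²` function along a line. -/
lemma hasDerivAt_comp_line {F : ℂ → ℝ} {z : ℂ} (hF : ContDiffAt ℝ 2 F z) (v : ℂ) :
    (∀ᶠ s : ℝ in nhds 0, HasDerivAt (fun s : ℝ => F (z + s • v)) (fderiv ℝ F (z + s • v) v) s) ∧
    HasDerivAt (fun s : ℝ => fderiv ℝ F (z + s • v) v) (iteratedFDeriv ℝ 2 F z ![v, v]) 0 := by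
  have hline : ∀ s : ℝ, HasDerivAt (fun s : ℝ => z + s • v) v s := fun s => by
    simpa using ((hasDerivAt_id s).smul_const v).const_add z
  have hcont : Tendsto (fun s : ℝ => z + s • v) (nhds 0) (nhds z) := by
    simpa using (hline 0).continuousAt.tendsto
  constructor
  · filter_upwards [hcont.eventually (hF.eventually (by simp))] with s hs
    exact (hs.differentiableAt (by simp)).hasFDerivAt.comp_hasDerivAt s (hline s)
  · have h2 : DifferentiableAt ℝ (fderiv ℝ F) (z + (0 : ℝ) • v) := by
      simpa using (hF.fderiv_right (m := 1) (by norm_num)).differentiableAt (by simp)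
    have h3 := h2.hasFDerivAt.comp_hasDerivAt (0 : ℝ) (hline 0)
    have h4 := h3.clm_apply (hasDerivAt_const (0 : ℝ) v)
    rw [iteratedFDeriv_two_apply]
    simpa using h4

/-- Second directional derivative of `log f` at a local maximum of `f` times a concave
paraboloid. -/
lemma iteratedFDeriv_log_le {f : ℂ → ℝ} {z v : ℂ} {q A c : ℝ} {Q : ℂ → ℝ}
    (hf : ContDiffAt ℝ 2 f z) (hpos : 0 < f z) (hq : 0 < q)
    (hQ : ∀ s : ℝ, Q (z + s • v) = q - A * (2 * s * c + s ^ 2))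
    (hmax : IsLocalMax (fun y => f y * Q y) z) :
    iteratedFDeriv ℝ 2 (fun y => Real.log (f y)) z ![v, v] ≤
      2 * A / q + 4 * A ^ 2 * c ^ 2 / q ^ 2 := by
  have hF : ContDiffAt ℝ 2 (fun y => Real.log (f y)) z := hf.log hpos.ne'
  obtain ⟨h1, h2⟩ := hasDerivAt_comp_line hF v
  set p : ℝ → ℝ := fun s => q - A * (2 * s * c + s ^ 2) with hp
  have hp' : ∀ s, HasDerivAt p (-(A * (2 * c + 2 * s))) s := fun s => by
    have := ((((hasDerivAt_id s).const_mul 2).mul_const c).add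
      ((hasDerivAt_id s).pow 2)).const_mul A |>.const_sub q
    exact this.congr_deriv (by simp)
  have hp0 : p 0 = q := by simp [hp]
  have hcont : Tendsto (fun s : ℝ => z + s • v) (nhds 0) (nhds z) := by
    have : Continuous (fun s : ℝ => z + s • v) := by fun_prop
    simpa using this.tendsto 0
  have hppos : ∀ᶠ s in nhds (0 : ℝ), 0 < p s :=
    (hp' 0).continuousAt.eventually_const_lt (by rw [hp0]; exact hq)
  have hfpos : ∀ᶠ s : ℝ in nhds 0, 0 < f (z + s • v) :=
    hcont.eventually (hf.continuousAt.eventually_const_lt hpos)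
  have h3 : ∀ᶠ s in nhds (0 : ℝ),
      HasDerivAt (fun s => Real.log (p s)) (-(A * (2 * c + 2 * s)) / p s) s :=
    hppos.mono fun s hs => (hp' s).log hs.ne'
  have h4 : HasDerivAt (fun s => -(A * (2 * c + 2 * s)) / p s)
      (-(2 * A / q + 4 * A ^ 2 * c ^ 2 / q ^ 2)) 0 := by
    have hn : HasDerivAt (fun s : ℝ => -(A * (2 * c + 2 * s))) (-(A * 2)) 0 := by
      exact ((((hasDerivAt_id (0 : ℝ)).const_mul 2).const_add (2 * c)).const_mul A).neg.congr_deriv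
        (by simp)
    refine (hn.div (hp' 0) (by rw [hp0]; exact hq.ne')).congr_deriv ?_
    rw [hp0]
    field_simp
    ring
  have hm : IsLocalMax (fun s : ℝ => Real.log (f (z + s • v)) + Real.log (p s)) 0 := by
    filter_upwards [hcont.eventually hmax, hppos, hfpos] with s hs1 hs2 hs3
    have e : Q z = q := by simpa using hQ 0
    rw [hQ s, e] at hs1
    rw [← Real.log_mul hs3.ne' hs2.ne', ← Real.log_mul (by simpa using hpos.ne')
      (by rw [hp0]; exact hq.ne')]
    refine Real.log_le_log (mul_pos hs3 hs2) ?_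
    simpa [hp0] using hs1
  have := hm.second_deriv_nonpos ((h1.and h3).mono fun s hs => hs.1.add hs.2) (h2.add h4)
  linarith

/-- Laplacian estimate at an interior maximum of `f` times a concave paraboloid. -/
lemma lap_log_le {f : ℂ → ℝ} {z z₀ : ℂ} {b A : ℝ} (hf : ContDiffAt ℝ 2 f z) (hpos : 0 < f z)
    (hq : 0 < b - A * ‖z - z₀‖ ^ 2)
    (hmax : IsLocalMax (fun y => f y * (b - A * ‖y - z₀‖ ^ 2)) z) :
    lap (fun y => Real.log (f y)) z ≤ 4 * A * b / (b - A * ‖z - z₀‖ ^ 2) ^ 2 := by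
  have h1 := iteratedFDeriv_log_le (v := 1) (c := (z - z₀).re) (A := A) hf hpos hq
    (fun s => by
      simp only [← Complex.normSq_eq_norm_sq, Complex.normSq_apply]
      simp; ring) hmax
  have h2 := iteratedFDeriv_log_le (v := Complex.I) (c := (z - z₀).im) (A := A) hf hpos hq
    (fun s => by
      simp only [← Complex.normSq_eq_norm_sq, Complex.normSq_apply]
      simp; ring) hmax
  have h3 : ‖z - z₀‖ ^ 2 = (z - z₀).re ^ 2 + (z - z₀).im ^ 2 := by
    rw [← Complex.normSq_eq_norm_sq, Complex.normSq_apply]; ring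
  refine (add_le_add h1 h2).trans (le_of_eq ?_)
  have : b = (b - A * ‖z - z₀‖ ^ 2) + A * ((z - z₀).re ^ 2 + (z - z₀).im ^ 2) := by
    rw [h3]; ring
  generalize b - A * ‖z - z₀‖ ^ 2 = q at *
  rw [this]
  field_simp
  ring

/-- A derivative is nonnegative at a point where the function is maximal from the left. -/
lemma HasDerivAt.nonneg_of_left_max {φ : ℝ → ℝ} {d a t : ℝ} (h : HasDerivAt φ d t) (hat : a < t)
    (hmax : ∀ s ∈ Ioo a t, φ s ≤ φ t) : 0 ≤ d := by
  have h1 : Tendsto (slope φ t) (nhdsWithin t (Iio t)) (nhds d) :=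
    (hasDerivAt_iff_tendsto_slope.1 h).mono_left
      (nhdsWithin_mono _ fun s (hs : s < t) => hs.ne)
  refine ge_of_tendsto h1 ?_
  filter_upwards [Ioo_mem_nhdsLT hat] with s hs
  rw [slope_def_field]
  exact div_nonneg_of_nonpos (by linarith [hmax s hs]) (by linarith [hs.2])

lemma ConfRFS.contDiffAt {T : ℝ} {M : Set (ℂ × ℝ)} {u : ℂ → ℝ → ℝ} (hRF : ConfRFS T M u)
    {p : ℂ × ℝ} (hp : p ∈ M) : ContDiffAt ℝ 2 (fun p : ℂ × ℝ => u p.1 p.2) p :=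
  (hRF.smooth.contDiffAt (hRF.opn.mem_nhds hp)).of_le (WithTop.coe_le_coe.2 (le_top (a := (2 : ℕ∞))))

lemma ConfRFS.contDiffAt_slice {T : ℝ} {M : Set (ℂ × ℝ)} {u : ℂ → ℝ → ℝ} (hRF : ConfRFS T M u)
    {z : ℂ} {t : ℝ} (hp : (z, t) ∈ M) : ContDiffAt ℝ 2 (fun y => u y t) z := by
  have := hRF.contDiffAt hp
  exact this.comp (f := fun y : ℂ => (y, t)) z (by fun_prop)

lemma ConfRFS.hasDerivAt_time {T : ℝ} {M : Set (ℂ × ℝ)} {u : ℂ → ℝ → ℝ} (hRF : ConfRFS T M u)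
    {z : ℂ} {t : ℝ} (hp : (z, t) ∈ M) :
    HasDerivAt (u z) (lap (fun y => Real.log (u y t)) z) t := by
  rw [← hRF.lfde _ hp]
  have h1 : DifferentiableAt ℝ (fun p : ℂ × ℝ => u p.1 p.2) (z, t) :=
    (hRF.contDiffAt hp).differentiableAt (by simp)
  exact (h1.comp (f := fun s : ℝ => (z, s)) t (by fun_prop)).hasDerivAt

/-- Comparison with the universal barrier on a compact shrinking paraboloid in `M`. -/
lemma ConfRFS.mul_paraboloid_le_of_compact {T : ℝ} {M : Set (ℂ × ℝ)} {u : ℂ → ℝ → ℝ}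
    (hRF : ConfRFS T M u) {z₀ : ℂ} {t₀ t₁ A b Φ : ℝ} (hA : 0 < A)
    (hsub : ∀ z t, t ∈ Icc t₀ t₁ → 0 ≤ b - t - A * ‖z - z₀‖ ^ 2 → (z, t) ∈ M)
    (h0 : ∀ z, 0 ≤ b - t₀ - A * ‖z - z₀‖ ^ 2 → u z t₀ * (b - t₀ - A * ‖z - z₀‖ ^ 2) ≤ Φ)
    (hΦ : 4 * A * (b - t₀) ≤ Φ) (hΦ0 : 0 ≤ Φ) {z : ℂ} {t : ℝ} (ht : t ∈ Icc t₀ t₁)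
    (hq : 0 ≤ b - t - A * ‖z - z₀‖ ^ 2) : u z t * (b - t - A * ‖z - z₀‖ ^ 2) ≤ Φ := by
  set q : ℂ × ℝ → ℝ := fun p => b - p.2 - A * ‖p.1 - z₀‖ ^ 2 with hqdef
  have hqc : Continuous q := by fun_prop
  set K : Set (ℂ × ℝ) := {p | p.2 ∈ Icc t₀ t₁ ∧ 0 ≤ q p} with hK
  have hKM : K ⊆ M := fun p hp => hsub p.1 p.2 hp.1 hp.2
  have hKc : IsCompact K := by
    refine ((isCompact_closedBall z₀ (Real.sqrt ((b - t₀) / A))).prod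
      (isCompact_Icc (a := t₀) (b := t₁))).of_isClosed_subset ?_ ?_
    · exact (isClosed_Icc.preimage continuous_snd).inter (isClosed_Ici.preimage hqc)
    · rintro ⟨y, s⟩ ⟨h1, h2⟩
      refine ⟨?_, h1⟩
      rw [mem_closedBall, dist_eq_norm]
      apply Real.le_sqrt_of_sq_le
      rw [le_div_iff₀ hA]
      simp only [hqdef] at h2
      linarith [h1.1]
  have hgc : ContinuousOn (fun p : ℂ × ℝ => u p.1 p.2 * q p) K :=
    (hRF.smooth.continuousOn.mono hKM).mul hqc.continuousOn
  obtain ⟨⟨y, s⟩, ⟨hs, hys⟩, hmax⟩ := hKc.exists_isMaxOn ⟨(z, t), ht, hq⟩ hgc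
  have hyM := hKM ⟨hs, hys⟩
  have hle : u z t * q (z, t) ≤ u y s * q (y, s) := hmax (show (z, t) ∈ K from ⟨ht, hq⟩)
  refine hle.trans ?_
  rcases hs.1.eq_or_lt with rfl | hs0
  · exact h0 y hys
  rcases hys.eq_or_lt with hq0 | hqpos
  · rw [← hq0, mul_zero]; exact hΦ0
  have hu := hRF.pos _ hyM
  simp only at hu hs hs0
  have hloc : IsLocalMax (fun x => u x s * (b - s - A * ‖x - z₀‖ ^ 2)) y := by
    have hc : Continuous fun x : ℂ => q (x, s) := by fun_prop
    filter_upwards [hc.continuousAt.eventually_const_lt hqpos] with x hx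
    exact hmax (show (x, s) ∈ K from ⟨hs, hx.le⟩)
  have hlap := lap_log_le (hRF.contDiffAt_slice hyM) hu hqpos hloc
  have hder : HasDerivAt (fun r => u y r * q (y, r))
      (lap (fun x => Real.log (u x s)) y * q (y, s) + u y s * (-1)) s := by
    refine (hRF.hasDerivAt_time hyM).mul ?_
    exact ((hasDerivAt_id' s).const_sub b).sub_const (A * ‖y - z₀‖ ^ 2)
  have htime := hder.nonneg_of_left_max hs0 fun r hr => by
    refine hmax (show (y, r) ∈ K from ⟨⟨hr.1.le, hr.2.le.trans hs.2⟩, ?_⟩)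
    have : q (y, s) ≤ q (y, r) := by simp only [hqdef]; linarith [hr.2]
    exact hys.trans this
  change _ ≤ _ / (q (y, s)) ^ 2 at hlap
  rw [le_div_iff₀ (by positivity)] at hlap
  have h5 : u y s * q (y, s) ≤ 4 * A * (b - s) := by nlinarith
  nlinarith

/-- Comparison with the universal barrier on an open shrinking paraboloid in `M`. -/
lemma ConfRFS.mul_paraboloid_le {T : ℝ} {M : Set (ℂ × ℝ)} {u : ℂ → ℝ → ℝ}
    (hRF : ConfRFS T M u) {z₀ : ℂ} {t₀ t₁ A b Φ : ℝ} (hA : 0 < A) (h01 : t₀ ≤ t₁)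
    (hsub : ∀ z t, t ∈ Icc t₀ t₁ → 0 < b - t - A * ‖z - z₀‖ ^ 2 → (z, t) ∈ M)
    (h0 : ∀ z, 0 < b - t₀ - A * ‖z - z₀‖ ^ 2 → u z t₀ * (b - t₀ - A * ‖z - z₀‖ ^ 2) ≤ Φ)
    (hΦ : 4 * A * (b - t₀) ≤ Φ) (hΦ0 : 0 ≤ Φ) {z : ℂ} {t : ℝ} (ht : t ∈ Icc t₀ t₁)
    (hq : 0 < b - t - A * ‖z - z₀‖ ^ 2) : u z t * (b - t - A * ‖z - z₀‖ ^ 2) ≤ Φ := by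
  have key : ∀ ε ∈ Ioo 0 (b - t - A * ‖z - z₀‖ ^ 2),
      u z t * (b - ε - t - A * ‖z - z₀‖ ^ 2) ≤ Φ := by
    intro ε hε
    refine hRF.mul_paraboloid_le_of_compact hA (fun y s hs hy => hsub y s hs (by linarith [hε.1]))
      (fun y hy => ?_) (by nlinarith [hε.1]) hΦ0 ht (by linarith [hε.2])
    have hy' : 0 < b - t₀ - A * ‖y - z₀‖ ^ 2 := by linarith [hε.1]
    have := hRF.pos _ (hsub y t₀ ⟨le_rfl, h01⟩ hy')
    simp only at this
    exact (mul_le_mul_of_nonneg_left (by linarith [hε.1]) this.le).trans (h0 y hy')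
  have hlim : Tendsto (fun ε : ℝ => u z t * (b - ε - t - A * ‖z - z₀‖ ^ 2))
      (nhdsWithin 0 (Ioi 0)) (nhds (u z t * (b - 0 - t - A * ‖z - z₀‖ ^ 2))) := by
    have : Continuous (fun ε : ℝ => u z t * (b - ε - t - A * ‖z - z₀‖ ^ 2)) := by fun_prop
    exact (this.tendsto 0).mono_left nhdsWithin_le_nhds
  rw [sub_zero] at hlim
  exact le_of_tendsto hlim (by filter_upwards [Ioo_mem_nhdsGT hq] with ε hε using key ε hε)

/-- Two points of a connected component of an open set are joined by a `C¹` path. -/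
lemma exists_contDiff_path {Ω : Set ℂ} (hΩ : IsOpen Ω) {x₀ x y : ℂ}
    (hx : x ∈ connectedComponentIn Ω x₀) (hy : y ∈ connectedComponentIn Ω x₀) :
    ∃ γ : ℝ → ℂ, ContDiff ℝ 1 γ ∧ (∀ s, γ s ∈ Ω) ∧ (∀ s ≤ 0, γ s = x) ∧ (∀ s, 1 ≤ s → γ s = y) := by
  refine isPreconnected_connectedComponentIn.induction₂ (fun x y => ∃ γ : ℝ → ℂ, ContDiff ℝ 1 γ ∧
    (∀ s, γ s ∈ Ω) ∧ (∀ s ≤ 0, γ s = x) ∧ (∀ s, 1 ≤ s → γ s = y)) ?_ ?_ ?_ hx hy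
  · intro x hx
    obtain ⟨r, hr, hball⟩ := Metric.isOpen_iff.1 hΩ x (connectedComponentIn_subset _ _ hx)
    filter_upwards [nhdsWithin_le_nhds (ball_mem_nhds x hr)] with y hy
    refine ⟨fun s => x + Real.smoothTransition s • (y - x), ?_, fun s => ?_, fun s hs => ?_,
      fun s hs => ?_⟩
    · exact contDiff_const.add (Real.smoothTransition.contDiff.smul contDiff_const)
    · exact hball ((convex_ball x r).add_smul_sub_mem (mem_ball_self hr) hy
        ⟨Real.smoothTransition.nonneg s, Real.smoothTransition.le_one s⟩)
    · simp [Real.smoothTransition.zero_of_nonpos hs]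
    · simp [Real.smoothTransition.one_of_one_le hs]
  · rintro x y z - - - ⟨γ, hγ, hγΩ, hγ0, hγ1⟩ ⟨η, hη, hηΩ, hη0, hη1⟩
    refine ⟨fun s => γ (2 * s) + η (2 * s - 1) - y, by fun_prop, fun s => ?_, fun s hs => ?_,
      fun s hs => ?_⟩
    · rcases le_total (2 * s) 1 with h | h
      · simpa [hη0 (2 * s - 1) (by linarith)] using hγΩ _
      · simpa [hγ1 (2 * s) h] using hηΩ _
    · simp [hη0 (2 * s - 1) (by linarith), hγ0 (2 * s) (by linarith)]
    · simp [hη1 (2 * s - 1) (by linarith), hγ1 (2 * s) (by linarith)]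
  · rintro x y - - ⟨γ, hγ, hγΩ, hγ0, hγ1⟩
    exact ⟨fun s => γ (1 - s), by fun_prop, fun s => hγΩ _, fun s hs => hγ1 _ (by linarith),
      fun s hs => hγ0 _ (by linarith)⟩

lemma confDist_le {v : ℂ → ℝ} {Ω : Set ℂ} {γ : ℝ → ℂ} (h1 : ContDiffOn ℝ 1 γ (Icc 0 1))
    (h2 : ∀ s ∈ Icc (0 : ℝ) 1, γ s ∈ Ω) :
    confDist v Ω (γ 0) (γ 1) ≤
      ∫ s in (0 : ℝ)..1, Real.sqrt (v (γ s)) * ‖derivWithin γ (Icc 0 1) s‖ := by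
  refine csInf_le ⟨0, ?_⟩ ⟨γ, h1, h2, rfl, rfl, rfl⟩
  rintro L ⟨η, -, -, -, -, rfl⟩
  exact intervalIntegral.integral_nonneg zero_le_one fun s _ => by positivity

/-- A path reaching the centre of a ball from outside has length at least the radius times the
minimal conformal density on the ball. -/
lemma le_length_of_enter_ball {v : ℂ → ℝ} {Ω : Set ℂ} (hv : ContinuousOn v Ω) {l : ℂ} {δ c : ℝ}
    (hc0 : 0 ≤ c) (hc : ∀ z ∈ closedBall l δ, c ≤ Real.sqrt (v z))
    {γ : ℝ → ℂ} (h1 : ContDiffOn ℝ 1 γ (Icc 0 1)) (h2 : ∀ s ∈ Icc (0 : ℝ) 1, γ s ∈ Ω)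
    (hstart : δ ≤ dist (γ 0) l) (hend : γ 1 = l) :
    c * δ ≤ ∫ s in (0 : ℝ)..1, Real.sqrt (v (γ s)) * ‖derivWithin γ (Icc 0 1) s‖ := by
  have hγc := h1.continuousOn
  have hdc : ContinuousOn (derivWithin γ (Icc 0 1)) (Icc 0 1) :=
    h1.continuousOn_derivWithin (uniqueDiffOn_Icc zero_lt_one) le_rfl
  have hint : ContinuousOn (fun s => Real.sqrt (v (γ s)) * ‖derivWithin γ (Icc 0 1) s‖)
      (Icc 0 1) := (hv.comp hγc h2).sqrt.mul hdc.norm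
  have hSc : IsCompact {s ∈ Icc (0 : ℝ) 1 | δ ≤ dist (γ s) l} := by
    have : IsClosed (Icc (0 : ℝ) 1 ∩ (fun s => dist (γ s) l) ⁻¹' Ici δ) :=
      ((continuous_id.dist continuous_const).comp_continuousOn hγc).preimage_isClosed_of_isClosed isClosed_Icc isClosed_Ici
    exact isCompact_Icc.of_isClosed_subset this inter_subset_left
  obtain ⟨r, ⟨hr, hrδ⟩, hrmax⟩ := hSc.exists_isGreatest ⟨0, ⟨le_rfl, zero_le_one⟩, hstart⟩
  have hsub : Icc r 1 ⊆ Icc 0 1 := Icc_subset_Icc_left hr.1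
  have hFTC : ∫ s in r..1, derivWithin γ (Icc 0 1) s = γ 1 - γ r := by
    refine intervalIntegral.integral_eq_sub_of_hasDerivAt_of_le hr.2 (hγc.mono hsub)
      (fun s hs => ?_) ((hdc.mono hsub).intervalIntegrable_of_Icc hr.2)
    have hs' : s ∈ Ioo (0 : ℝ) 1 := ⟨hr.1.trans_lt hs.1, hs.2⟩
    exact ((h1.differentiableOn (by simp)) s (Ioo_subset_Icc_self hs')).hasDerivWithinAt.hasDerivAt
      (Icc_mem_nhds hs'.1 hs'.2)
  have hδ : δ ≤ ∫ s in r..1, ‖derivWithin γ (Icc 0 1) s‖ := by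
    refine le_trans ?_ (intervalIntegral.norm_integral_le_integral_norm hr.2)
    rw [hFTC, hend, ← dist_eq_norm, dist_comm]
    exact hrδ
  have hI1 : IntervalIntegrable (fun s => Real.sqrt (v (γ s)) * ‖derivWithin γ (Icc 0 1) s‖)
      volume 0 r := (hint.mono (Icc_subset_Icc_right hr.2)).intervalIntegrable_of_Icc hr.1
  have hI2 : IntervalIntegrable (fun s => Real.sqrt (v (γ s)) * ‖derivWithin γ (Icc 0 1) s‖)
      volume r 1 := (hint.mono hsub).intervalIntegrable_of_Icc hr.2
  rw [← intervalIntegral.integral_add_adjacent_intervals hI1 hI2]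
  have hnn : 0 ≤ ∫ s in (0 : ℝ)..r, Real.sqrt (v (γ s)) * ‖derivWithin γ (Icc 0 1) s‖ :=
    intervalIntegral.integral_nonneg hr.1 fun s _ => by positivity
  have hlow : ∫ s in r..1, c * ‖derivWithin γ (Icc 0 1) s‖ ≤
      ∫ s in r..1, Real.sqrt (v (γ s)) * ‖derivWithin γ (Icc 0 1) s‖ := by
    refine intervalIntegral.integral_mono_on_of_le_Ioo hr.2
      ((hdc.mono hsub).norm.const_mul c |>.intervalIntegrable_of_Icc hr.2) hI2 fun s hs => ?_
    refine mul_le_mul_of_nonneg_right (hc _ ?_) (norm_nonneg _)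
    by_contra hcon
    rw [mem_closedBall, not_le] at hcon
    have := hrmax ⟨hsub (Ioo_subset_Icc_self hs), hcon.le⟩
    linarith [hs.1]
  rw [intervalIntegral.integral_const_mul] at hlow
  nlinarith [mul_le_mul_of_nonneg_left hδ hc0]

/-- Radial distance estimate in a ball where the conformal factor is at most of order the inverse
distance to the boundary sphere. -/
lemma confDist_radial_le {v : ℂ → ℝ} {Ω : Set ℂ} {z₀ z₁ : ℂ} {C : ℝ} (hne : z₁ ≠ z₀)
    (hball : ball z₀ ‖z₁ - z₀‖ ⊆ Ω) (hpos : ∀ z ∈ Ω, 0 < v z)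
    (hbd : ∀ z ∈ ball z₀ ‖z₁ - z₀‖, v z * (‖z₁ - z₀‖ ^ 2 - ‖z - z₀‖ ^ 2) ≤ C)
    {σ τ : ℝ} (hσ : σ ∈ Ioc (0 : ℝ) 1) (hτ : τ ∈ Ioc (0 : ℝ) 1) :
    confDist v Ω (z₀ + (1 - σ ^ 2) • (z₁ - z₀)) (z₀ + (1 - τ ^ 2) • (z₁ - z₀)) ≤
      2 * Real.sqrt C * |τ - σ| := by
  have hρ : 0 < ‖z₁ - z₀‖ := norm_pos_iff.2 (sub_ne_zero.2 hne)
  set w : ℝ → ℝ := fun s => σ + s * (τ - σ) with hw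
  set γ : ℝ → ℂ := fun s => z₀ + (1 - (w s) ^ 2) • (z₁ - z₀) with hγ
  have hwI : ∀ s ∈ Icc (0 : ℝ) 1, w s ∈ Ioc (0 : ℝ) 1 := fun s hs => by
    have := (convex_Ioc (0 : ℝ) 1).add_smul_sub_mem hσ hτ hs
    simpa [hw] using this
  have hnorm : ∀ s ∈ Icc (0 : ℝ) 1, ‖γ s - z₀‖ = (1 - w s ^ 2) * ‖z₁ - z₀‖ := fun s hs => by
    have h1 : 0 ≤ 1 - w s ^ 2 := by nlinarith [(hwI s hs).1, (hwI s hs).2]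
    simp only [hγ, add_sub_cancel_left, norm_smul, Real.norm_eq_abs, abs_of_nonneg h1]
  have hmem : ∀ s ∈ Icc (0 : ℝ) 1, γ s ∈ ball z₀ ‖z₁ - z₀‖ := fun s hs => by
    rw [mem_ball, dist_eq_norm, hnorm s hs]
    have := (hwI s hs).1
    nlinarith [mul_pos (mul_pos this this) hρ]
  have hder : ∀ s, HasDerivAt γ ((-(2 * w s * (τ - σ))) • (z₁ - z₀)) s := fun s => by
    have h1 : HasDerivAt w (τ - σ) s := by
      exact (((hasDerivAt_id' s).mul_const (τ - σ)).const_add σ).congr_deriv (by simp)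
    have h2 : HasDerivAt (fun s => 1 - w s ^ 2) (-(2 * w s * (τ - σ))) s :=
      ((h1.pow 2).const_sub 1).congr_deriv (by simp)
    exact (h2.smul_const (z₁ - z₀)).const_add z₀
  have hC : ContDiff ℝ 1 γ := by fun_prop
  have h01 := confDist_le (v := v) hC.contDiffOn fun s hs => hball (hmem s hs)
  have e0 : γ 0 = z₀ + (1 - σ ^ 2) • (z₁ - z₀) := by simp [hγ, hw]
  have e1 : γ 1 = z₀ + (1 - τ ^ 2) • (z₁ - z₀) := by simp [hγ, hw]
  rw [e0, e1] at h01
  refine h01.trans ((le_abs_self _).trans ?_)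
  rw [← Real.norm_eq_abs]
  refine (intervalIntegral.norm_integral_le_of_norm_le_const
    (C := 2 * Real.sqrt C * |τ - σ|) fun s hs => ?_).trans (by simp)
  rw [uIoc_of_le zero_le_one] at hs
  have hs' := Ioc_subset_Icc_self hs
  obtain ⟨hw0, hw1⟩ := hwI s hs'
  have hv := hpos _ (hball (hmem s hs'))
  have hb := hbd _ (hmem s hs')
  rw [hnorm s hs'] at hb
  rw [(hder s).hasDerivWithinAt.derivWithin (uniqueDiffOn_Icc zero_lt_one s hs')]
  have hkey : Real.sqrt (v (γ s)) * (w s * ‖z₁ - z₀‖) ≤ Real.sqrt C := by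
    rw [← Real.sqrt_sq (show 0 ≤ w s * ‖z₁ - z₀‖ by positivity), ← Real.sqrt_mul hv.le]
    refine Real.sqrt_le_sqrt (le_trans ?_ hb)
    have : 0 ≤ v (γ s) * (w s * ‖z₁ - z₀‖) ^ 2 * (1 - w s ^ 2) :=
      mul_nonneg (by positivity) (by nlinarith)
    nlinarith
  rw [Real.norm_of_nonneg (by positivity), norm_smul, norm_neg, Real.norm_eq_abs, abs_mul,
    abs_of_pos (show 0 < 2 * w s by positivity)]
  calc _ = 2 * (Real.sqrt (v (γ s)) * (w s * ‖z₁ - z₀‖)) * |τ - σ| := by ring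
    _ ≤ _ := by gcongr

/-- A conformal metric whose factor is at most of order the inverse distance to the boundary sphere
of a ball touching the complement of `Ω` is incomplete. -/
lemma not_confComplete_of_ball_touches {v : ℂ → ℝ} {Ω : Set ℂ} (hΩ : IsOpen Ω)
    (hvc : ContinuousOn v Ω) (hpos : ∀ z ∈ Ω, 0 < v z) {z₀ z₁ : ℂ} {C : ℝ} (hne : z₁ ≠ z₀)
    (hz₁ : z₁ ∉ Ω) (hball : ball z₀ ‖z₁ - z₀‖ ⊆ Ω)
    (hbd : ∀ z ∈ ball z₀ ‖z₁ - z₀‖, v z * (‖z₁ - z₀‖ ^ 2 - ‖z - z₀‖ ^ 2) ≤ C) :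
    ¬ ConfComplete v Ω := by
  intro hcomp
  have hρ : 0 < ‖z₁ - z₀‖ := norm_pos_iff.2 (sub_ne_zero.2 hne)
  set σ : ℕ → ℝ := fun n => 1 / ((n : ℝ) + 1) with hσ
  have hσI : ∀ n, σ n ∈ Ioc (0 : ℝ) 1 := fun n =>
    ⟨by positivity, by rw [hσ, div_le_one (by positivity)]; linarith [n.cast_nonneg (α := ℝ)]⟩
  have hσ0 : Tendsto σ atTop (nhds 0) := tendsto_one_div_add_atTop_nhds_zero_nat
  set x : ℕ → ℂ := fun n => z₀ + (1 - σ n ^ 2) • (z₁ - z₀) with hx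
  have hxlim : Tendsto x atTop (nhds z₁) := by
    have : Continuous fun s : ℝ => z₀ + (1 - s ^ 2) • (z₁ - z₀) := by fun_prop
    have h := (this.tendsto 0).comp hσ0
    simp only [ne_eq, OfNat.ofNat_ne_zero, not_false_eq_true, zero_pow, sub_zero, one_smul,
      add_sub_cancel] at h
    exact h
  have hz₀ : z₀ ∈ ball z₀ ‖z₁ - z₀‖ := mem_ball_self hρ
  have hxmem : ∀ n, x n ∈ connectedComponentIn Ω z₀ := fun n => by
    refine (convex_ball z₀ _).isPreconnected.subset_connectedComponentIn hz₀ hball ?_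
    have h1 := (hσI n).1
    have h2 : 0 ≤ 1 - σ n ^ 2 := by nlinarith [(hσI n).2]
    rw [mem_ball, dist_eq_norm, hx, add_sub_cancel_left, norm_smul, Real.norm_of_nonneg h2]
    nlinarith [mul_pos (mul_pos h1 h1) hρ]
  have hcauchy : ∀ ε : ℝ, 0 < ε → ∃ N : ℕ, ∀ m ≥ N, ∀ n ≥ N, confDist v Ω (x m) (x n) < ε := by
    intro ε hε
    obtain ⟨N, hN⟩ := Metric.cauchySeq_iff.1 hσ0.cauchySeq (ε / (2 * Real.sqrt C + 1))
      (by positivity)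
    refine ⟨N, fun m hm n hn =>
      (confDist_radial_le hne hball hpos hbd (hσI m) (hσI n)).trans_lt ?_⟩
    have := hN n hn m hm
    rw [Real.dist_eq, lt_div_iff₀ (by positivity)] at this
    nlinarith [abs_nonneg (σ n - σ m)]
  obtain ⟨l, hl, hlim⟩ := hcomp z₀ (hball hz₀) x hxmem hcauchy
  have hlΩ := connectedComponentIn_subset _ _ hl
  have hlz : l ≠ z₁ := fun h => hz₁ (h ▸ hlΩ)
  have hd : 0 < dist z₁ l := dist_pos.2 hlz.symm
  have hev : ∀ᶠ z in nhds l, z ∈ Ω ∧ v l / 4 < v z :=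
    Filter.Eventually.and (hΩ.mem_nhds hlΩ) ((hvc.continuousAt (hΩ.mem_nhds hlΩ)).eventually_const_lt
      (by linarith [hpos l hlΩ]))
  obtain ⟨r, hr, hrball⟩ := Metric.nhds_basis_closedBall.eventually_iff.1 hev
  set δ := min r (dist z₁ l / 2) with hδ
  have hδ0 : 0 < δ := lt_min hr (by positivity)
  have hc0 : 0 < Real.sqrt (v l / 4) := Real.sqrt_pos.2 (by linarith [hpos l hlΩ])
  have hfar : ∀ᶠ n in atTop, δ ≤ dist (x n) l := by
    have : Tendsto (fun n => dist (x n) l) atTop (nhds (dist z₁ l)) := hxlim.dist tendsto_const_nhds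
    filter_upwards [this.eventually_const_lt (half_lt_self hd)] with n hn
    exact (min_le_right _ _).trans hn.le
  have hlow : ∀ᶠ n in atTop, Real.sqrt (v l / 4) * δ ≤ confDist v Ω (x n) l := by
    filter_upwards [hfar] with n hn
    refine le_csInf ?_ ?_
    · obtain ⟨γ, h1, h2, h3, h4⟩ := exists_contDiff_path hΩ (hxmem n) hl
      exact ⟨_, γ, h1.contDiffOn, fun s _ => h2 s, h3 0 le_rfl, h4 1 le_rfl, rfl⟩
    · rintro L ⟨γ, h1, h2, h3, h4, rfl⟩
      exact le_length_of_enter_ball hvc hc0.le (fun z hz => Real.sqrt_le_sqrt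
        (hrball (closedBall_subset_closedBall (min_le_left _ _) hz)).2.le) h1 h2 (h3 ▸ hn) h4
  have := le_of_tendsto_of_tendsto tendsto_const_nhds hlim hlow
  nlinarith [mul_pos hc0 hδ0]

/-- The time until which the worldline of `z` starting at time `t` stays in `M`. -/
noncomputable def survivalTime (T : ℝ) (M : Set (ℂ × ℝ)) (z : ℂ) (t : ℝ) : ℝ :=
  sSup {r : ℝ | r ∈ Icc t T ∧ ∀ s ∈ Ico t r, (z, s) ∈ M}

section SurvivalTime

variable {T t : ℝ} {M : Set (ℂ × ℝ)} {z : ℂ}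

lemma le_survivalTime_of_forall {r : ℝ} (hr : r ∈ Icc t T) (h : ∀ s ∈ Ico t r, (z, s) ∈ M) :
    r ≤ survivalTime T M z t :=
  le_csSup ⟨T, fun _ hx => hx.1.2⟩ ⟨hr, h⟩

lemma le_survivalTime (ht : t ≤ T) : t ≤ survivalTime T M z t :=
  le_survivalTime_of_forall ⟨le_rfl, ht⟩ (by simp)

lemma survivalTime_le (ht : t ≤ T) : survivalTime T M z t ≤ T :=
  csSup_le ⟨t, left_mem_Icc.2 ht, by simp⟩ fun _ hx => hx.1.2

lemma mem_of_lt_survivalTime (ht : t ≤ T) {s : ℝ} (hts : t ≤ s) (hs : s < survivalTime T M z t) :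
    (z, s) ∈ M := by
  have hne : {r : ℝ | r ∈ Icc t T ∧ ∀ s ∈ Ico t r, (z, s) ∈ M}.Nonempty :=
    ⟨t, left_mem_Icc.2 ht, by simp⟩
  obtain ⟨r, hr, hsr⟩ := exists_lt_of_lt_csSup hne hs
  exact hr.2 s ⟨hts, hsr⟩

lemma survivalTime_notMem (hM : IsOpen M) (ht : t ≤ T) (h : survivalTime T M z t < T) :
    (z, survivalTime T M z t) ∉ M := by
  intro hmem
  set τ := survivalTime T M z t with hτ
  have hev : ∀ᶠ s in nhds τ, (z, s) ∈ M :=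
    (Continuous.prodMk_right z).continuousAt.eventually (hM.mem_nhds hmem)
  obtain ⟨ε, hε, hball⟩ := Metric.eventually_nhds_iff.1 hev
  have hlt : τ < min T (τ + ε) := lt_min h (by linarith)
  refine hlt.not_ge (le_survivalTime_of_forall
    ⟨(le_survivalTime ht).trans hlt.le, min_le_left _ _⟩ fun s hs => ?_)
  rcases lt_or_ge s τ with h1 | h1
  · exact mem_of_lt_survivalTime ht hs.1 h1
  · refine hball ?_
    rw [Real.dist_eq, abs_of_nonneg (by linarith)]
    linarith [hs.2.trans_le (min_le_right T (τ + ε))]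

lemma lt_survivalTime (hM : IsOpen M) (ht : t < T) (hz : (z, t) ∈ M) :
    t < survivalTime T M z t := by
  refine (le_survivalTime ht.le).lt_of_ne fun h => ?_
  have := survivalTime_notMem (z := z) hM ht.le (h ▸ ht)
  rw [← h] at this
  exact this hz

lemma survivalTime_eq_of_forall_mem {t' : ℝ} (htt : t ≤ t') (ht' : t' ≤ T)
    (h : ∀ s ∈ Icc t t', (z, s) ∈ M) : survivalTime T M z t = survivalTime T M z t' := by
  refine le_antisymm (csSup_le ⟨t, ⟨le_rfl, htt.trans ht'⟩, by simp⟩ ?_)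
    (csSup_le ⟨t', ⟨le_rfl, ht'⟩, by simp⟩ ?_)
  · rintro r ⟨hr, hrM⟩
    rcases le_total r t' with h1 | h1
    · exact h1.trans (le_survivalTime ht')
    · exact le_survivalTime_of_forall ⟨h1, hr.2⟩ fun s hs => hrM s ⟨htt.trans hs.1, hs.2⟩
  · rintro r ⟨hr, hrM⟩
    refine le_survivalTime_of_forall ⟨htt.trans hr.1, hr.2⟩ fun s hs => ?_
    rcases le_total s t' with h1 | h1
    · exact h s ⟨hs.1, h1⟩
    · exact hrM s ⟨h1, hs.2⟩

lemma lowerSemicontinuous_survivalTime (hM : IsOpen M) (ht : t ≤ T) :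
    LowerSemicontinuous fun z => survivalTime T M z t := by
  intro z r hr
  rcases lt_or_ge r t with h | h
  · exact Filter.Eventually.of_forall fun y => h.trans_le (le_survivalTime ht)
  obtain ⟨r', hr1, hr2⟩ := exists_between hr
  have hev : ∀ᶠ y in nhds z, ∀ s ∈ Icc t r', (y, s) ∈ M :=
    isCompact_Icc.eventually_forall_of_forall_eventually fun s hs =>
      hM.mem_nhds (mem_of_lt_survivalTime ht hs.1 (hs.2.trans_lt hr2))
  filter_upwards [hev] with y hy
  exact hr1.trans_le (le_survivalTime_of_forall
    ⟨h.trans hr1.le, hr2.le.trans (survivalTime_le ht)⟩ fun s hs => hy s ⟨hs.1, hs.2.le⟩)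

end SurvivalTime

/-- In a complete spacetime, the survival time varies at most quadratically. -/
lemma survivalTime_sub_le {T : ℝ} {M : Set (ℂ × ℝ)} {u : ℂ → ℝ → ℝ}
    (hRF : ConfRFS T M u) (hcomp : ConfRFSComplete T M u) {t₀ R : ℝ} (ht₀ : t₀ ∈ Ioo 0 T)
    (hR : 0 < R) {z₀ : ℂ} (hball : ∀ z ∈ closedBall z₀ R, (z, t₀) ∈ M) (a : ℂ) :
    survivalTime T M z₀ t₀ - survivalTime T M a t₀ ≤ T / R ^ 2 * ‖a - z₀‖ ^ 2 := by
  by_contra! hlt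
  have hT : 0 < T := ht₀.1.trans ht₀.2
  set A := T / R ^ 2 with hA
  have hA0 : 0 < A := by positivity
  have hAR : A * R ^ 2 = T := by rw [hA]; field_simp
  set τ : ℂ → ℝ := fun z => survivalTime T M z t₀ with hτ
  have hτT : ∀ z, τ z ≤ T := fun z => survivalTime_le ht₀.2.le
  have hτt : ∀ z, t₀ ≤ τ z := fun z => le_survivalTime ht₀.2.le
  change A * ‖a - z₀‖ ^ 2 < τ z₀ - τ a at hlt
  have hsmall : ∀ z, A * ‖z - z₀‖ ^ 2 < T → z ∈ closedBall z₀ R := fun z hz => by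
    rw [mem_closedBall, dist_eq_norm]
    refine (lt_of_pow_lt_pow_left₀ 2 hR.le (lt_of_mul_lt_mul_left ?_ hA0.le)).le
    rwa [hAR]
  have haB : a ∈ closedBall z₀ R := hsmall a (by linarith [hτT z₀, hτt a, ht₀.1])
  have hlsc : LowerSemicontinuousOn (fun z => τ z + A * ‖z - z₀‖ ^ 2) (closedBall z₀ R) := by
    refine LowerSemicontinuous.lowerSemicontinuousOn ?_ _
    exact (lowerSemicontinuous_survivalTime hRF.opn ht₀.2.le).add
      (Continuous.lowerSemicontinuous (by fun_prop))
  obtain ⟨z₁, hz₁B, hmin⟩ := hlsc.exists_isMinOn ⟨a, haB⟩ (isCompact_closedBall z₀ R)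
  set b := τ z₁ + A * ‖z₁ - z₀‖ ^ 2 with hb
  have hba : b < τ z₀ := by
    have : b ≤ τ a + A * ‖a - z₀‖ ^ 2 := hmin haB
    linarith
  have hbT : b < T := hba.trans_le (hτT z₀)
  have hne : z₁ ≠ z₀ := by
    rintro h
    rw [hb, h] at hba
    simp at hba
  have ht₁T : τ z₁ < T := lt_of_le_of_lt (le_add_of_nonneg_right (by positivity)) hbT
  have hz₁M : (z₁, τ z₁) ∉ M := survivalTime_notMem hRF.opn ht₀.2.le ht₁T
  have hsub : ∀ z t, t ∈ Icc t₀ (τ z₁) → 0 < b - t - A * ‖z - z₀‖ ^ 2 → (z, t) ∈ M := by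
    intro z t ht hq
    have hz := hsmall z (by linarith [ht.1, ht₀.1])
    have : b ≤ τ z + A * ‖z - z₀‖ ^ 2 := hmin hz
    exact mem_of_lt_survivalTime ht₀.2.le ht.1 (show t < τ z by linarith)
  have hcont : ContinuousOn (fun z => u z t₀) (closedBall z₀ R) := fun z hz =>
    (hRF.contDiffAt_slice (hball z hz)).continuousAt.continuousWithinAt
  obtain ⟨C, hC⟩ := (isCompact_closedBall z₀ R).exists_bound_of_continuousOn hcont
  have hC0 : 0 ≤ C := (norm_nonneg _).trans (hC a haB)
  have hbound := fun z hq => hRF.mul_paraboloid_le (Φ := 4 * A * T + C * T) hA0 (hτt z₁) hsub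
    (fun z hq => by
      have hz := hsmall z (by linarith [ht₀.1])
      have h1 : u z t₀ ≤ C := (le_abs_self _).trans (hC z hz)
      have h2 : b - t₀ - A * ‖z - z₀‖ ^ 2 ≤ T := by nlinarith [sq_nonneg ‖z - z₀‖, ht₀.1]
      have h3 := mul_le_mul h1 h2 hq.le hC0
      nlinarith)
    (by nlinarith [ht₀.1, mul_nonneg hC0 hT.le]) (by positivity) (z := z)
    (right_mem_Icc.2 (hτt z₁)) hq
  have hq : ∀ z, b - τ z₁ - A * ‖z - z₀‖ ^ 2 = A * (‖z₁ - z₀‖ ^ 2 - ‖z - z₀‖ ^ 2) := fun z => by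
    rw [hb]; ring
  have hqpos : ∀ z ∈ ball z₀ ‖z₁ - z₀‖, 0 < b - τ z₁ - A * ‖z - z₀‖ ^ 2 := fun z hz => by
    rw [hq]
    rw [mem_ball, dist_eq_norm] at hz
    exact mul_pos hA0 (sub_pos.2 (pow_lt_pow_left₀ hz (norm_nonneg _) two_ne_zero))
  have hΩ : IsOpen (timeSlice M (τ z₁)) := hRF.opn.preimage (Continuous.prodMk_left _)
  refine not_confComplete_of_ball_touches (v := fun z => u z (τ z₁))
    (C := (4 * A * T + C * T) / A) hΩ
    (fun z hz => (hRF.contDiffAt_slice hz).continuousAt.continuousWithinAt)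
    (fun z hz => hRF.pos _ hz) hne hz₁M
    (fun z hz => hsub z _ (right_mem_Icc.2 (hτt z₁)) (hqpos z hz)) (fun z hz => ?_)
    (hcomp (τ z₁) ⟨ht₀.1.trans_le (hτt z₁), ht₁T⟩)
  have := hbound z (hqpos z hz)
  rw [hq] at this
  rw [le_div_iff₀ hA0]
  linarith

/-- A function on a convex set whose increments are quadratically small is constant. -/
lemma Convex.eq_of_abs_sub_le_sq {E : Type*} [NormedAddCommGroup E] [NormedSpace ℝ E] {s : Set E}
    (hs : Convex ℝ s) {f : E → ℝ} {A : ℝ}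
    (h : ∀ x ∈ s, ∀ y ∈ s, |f y - f x| ≤ A * ‖y - x‖ ^ 2)
    {x y : E} (hx : x ∈ s) (hy : y ∈ s) : f x = f y := by
  have hder : ∀ x ∈ s, HasFDerivWithinAt f (0 : E →L[ℝ] ℝ) s x := fun x hx => by
    rw [hasFDerivWithinAt_iff_isLittleO]
    have h1 : (fun y => f y - f x - (0 : E →L[ℝ] ℝ) (y - x)) =O[nhdsWithin x s]
        fun y => ‖y - x‖ ^ 2 := by
      refine Asymptotics.IsBigO.of_bound A ?_
      filter_upwards [self_mem_nhdsWithin] with y hy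
      simpa using h x hx y hy
    refine h1.trans_isLittleO (Asymptotics.IsLittleO.mono ?_ nhdsWithin_le_nhds)
    have h2 : Tendsto (fun y => y - x) (nhds x) (nhds 0) := by
      have : Continuous fun y : E => y - x := by fun_prop
      simpa using this.tendsto x
    exact (Asymptotics.isLittleO_norm_pow_id one_lt_two).comp_tendsto h2
  have := hs.norm_image_sub_le_of_norm_hasFDerivWithin_le (C := 0) hder (by simp) hx hy
  rw [zero_mul, norm_le_zero_iff, sub_eq_zero] at this
  exact this.symm

/-- In a complete spacetime, the survival time is locally constant. -/
lemma eventually_survivalTime_eq {T : ℝ} {M : Set (ℂ × ℝ)} {u : ℂ → ℝ → ℝ}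
    (hRF : ConfRFS T M u) (hcomp : ConfRFSComplete T M u) {p : ℂ × ℝ} (hp : p ∈ M) :
    ∀ᶠ q in nhds p, survivalTime T M p.1 p.2 = survivalTime T M q.1 q.2 := by
  obtain ⟨c, t₀⟩ := p
  have ht₀ : t₀ ∈ Ioo 0 T := hRF.sub hp
  obtain ⟨r, hr, hball⟩ := Metric.nhds_basis_closedBall.mem_iff.1 (hRF.opn.mem_nhds hp)
  rw [← closedBall_prod_same] at hball
  have hR : 0 < r / 2 := by positivity
  have hslice : ∀ z ∈ closedBall c r, (z, t₀) ∈ M := fun z hz =>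
    hball ⟨hz, mem_closedBall_self hr.le⟩
  have hle : ∀ x ∈ ball c (r / 2), ∀ y, survivalTime T M x t₀ - survivalTime T M y t₀ ≤
      T / (r / 2) ^ 2 * ‖y - x‖ ^ 2 := fun x hx y =>
    survivalTime_sub_le hRF hcomp ht₀ hR (fun z hz => hslice z (closedBall_subset_closedBall'
      (by linarith [mem_ball.1 hx]) hz)) y
  have hconst : ∀ z ∈ ball c (r / 2), survivalTime T M c t₀ = survivalTime T M z t₀ := by
    intro z hz
    refine (convex_ball c (r / 2)).eq_of_abs_sub_le_sq (f := fun z => survivalTime T M z t₀)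
      (A := T / (r / 2) ^ 2) (fun x hx y hy => ?_) (mem_ball_self hR) hz
    refine abs_le.2 ⟨?_, ?_⟩
    · linarith [hle x hx y]
    · rw [norm_sub_rev]
      exact hle y hy x
  filter_upwards [ball_mem_nhds (c, t₀) hR, hRF.opn.mem_nhds hp] with q hq hqM
  obtain ⟨z, t⟩ := q
  rw [← ball_prod_same] at hq
  have ht : t ∈ Ioo 0 T := hRF.sub hqM
  have hzr : z ∈ closedBall c r := by
    have := mem_ball.1 hq.1
    exact mem_closedBall.2 (by linarith)
  have htr : t ∈ closedBall t₀ r := by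
    have := mem_ball.1 hq.2
    exact mem_closedBall.2 (by linarith)
  have hconn : ∀ s ∈ uIcc t₀ t, (z, s) ∈ M := fun s hs => hball ⟨hzr,
    (convex_closedBall t₀ r).ordConnected.uIcc_subset (mem_closedBall_self hr.le) htr hs⟩
  rw [hconst z hq.1]
  rcases le_total t₀ t with h | h
  · rw [uIcc_of_le h] at hconn
    exact survivalTime_eq_of_forall_mem h ht.2.le hconn
  · rw [uIcc_of_ge h] at hconn
    exact (survivalTime_eq_of_forall_mem h ht₀.2.le hconn).symm

/-- A complete conformal Ricci flow spacetime in `ℂ × (0,T)` is expanding. -/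
theorem complete_spacetime_expanding
    (T : ℝ) (hT : 0 < T) (M : Set (ℂ × ℝ)) (u : ℂ → ℝ → ℝ)
    (hRF : ConfRFS T M u) (hcomp : ConfRFSComplete T M u) :
    ∀ (z : ℂ) (t t' : ℝ), (z, t) ∈ M → t ≤ t' → t' < T → (z, t') ∈ M := by
  intro z t t' hz htt ht'
  have ht : t ∈ Ioo 0 T := hRF.sub hz
  obtain ⟨y, hy⟩ := hRF.nonempty t' ⟨ht.1.trans_le htt, ht'⟩
  have heq : survivalTime T M z t = survivalTime T M y t' :=
    hRF.conn.isPreconnected.induction₂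
      (fun p q => survivalTime T M p.1 p.2 = survivalTime T M q.1 q.2)
      (fun p hp => nhdsWithin_le_nhds (eventually_survivalTime_eq hRF hcomp hp))
      (fun _ _ _ _ _ _ h1 h2 => h1.trans h2) (fun _ _ _ _ h => h.symm) hz
      (show (y, t') ∈ M from hy)
  exact mem_of_lt_survivalTime ht.2.le htt (heq ▸ lt_survivalTime hRF.opn ht' hy)
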